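/- arXiv:2505.18439 — 2 statements merged into one kernel-verified Lean document; each statement's English description precedes it below -/
import Mathlib

section
/- There is no pair (r,y) with r > 0 and 0 < y < 1 such that ∂Z/∂r (r,y) = 0 and ∂²Z/∂r² (r,y) ≤ 0. -/
/-- H(r) = (kn−1)·coth(r) + (k−1)·tanh(r). -/
noncomputable def Hfun (k n : ℕ) (r : ℝ) : ℝ :=
  ((k : ℝ) * n - 1) * (Real.cosh r / Real.sinh r) + ((k : ℝ) - 1) * Real.tanh r

/-- Λ(r) = (kn−1)/sinh²(r) − (k−1)/cosh²(r). -/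
noncomputable def Lfun (k n : ℕ) (r : ℝ) : ℝ :=
  ((k : ℝ) * n - 1) / Real.sinh r ^ 2 - ((k : ℝ) - 1) / Real.cosh r ^ 2

/-- S(r,y) = y(1−y)/r − H(r)·y + Λ(r)·r + (λ₁−λ₂)·r. -/
noncomputable def Sfun (k n : ℕ) (lam1 lam2 : ℝ) (r y : ℝ) : ℝ :=
  y * (1 - y) / r - Hfun k n r * y + Lfun k n r * r + (lam1 - lam2) * r

/-- Z(r,y) = (y²−y)/r² + Λ(r)·(y+1) + Λ′(r)·r + 2λ₁·y − (λ₂−λ₁)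
      + S(r,y)²/(2y) + H(r)·S(r,y). -/
noncomputable def Zfun (k n : ℕ) (lam1 lam2 : ℝ) (r y : ℝ) : ℝ :=
  (y ^ 2 - y) / r ^ 2 + Lfun k n r * (y + 1) + deriv (Lfun k n) r * r + 2 * lam1 * y -
    (lam2 - lam1) + (Sfun k n lam1 lam2 r y) ^ 2 / (2 * y) +
    Hfun k n r * Sfun k n lam1 lam2 r y

noncomputable def ql0 (a b t : ℝ) : ℝ := a / t ^ 2 + b * t ^ 2 - a - b
noncomputable def ql1 (a b t : ℝ) : ℝ := (1 - t ^ 2) * (-2 * a / t ^ 3 + 2 * b * t)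
noncomputable def ql2 (a b t : ℝ) : ℝ :=
  (1 - t ^ 2) * (6 * a / t ^ 4 - 2 * a / t ^ 2 + 2 * b - 6 * b * t ^ 2)
noncomputable def ql3 (a b t : ℝ) : ℝ :=
  (1 - t ^ 2) * (-24 * a / t ^ 5 + 16 * a / t ^ 3 - 16 * b * t + 24 * b * t ^ 3)

theorem hasDerivAt_tanh_aux (x : ℝ) : HasDerivAt Real.tanh (1 - Real.tanh x ^ 2) x := by
  have hc : Real.cosh x ≠ 0 := (Real.cosh_pos x).ne'
  have h := (Real.hasDerivAt_sinh x).div (Real.hasDerivAt_cosh x) hc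
  have e : Real.tanh = fun x => Real.sinh x / Real.cosh x := by
    funext u; exact Real.tanh_eq_sinh_div_cosh u
  have h2 : HasDerivAt Real.tanh ((Real.cosh x * Real.cosh x - Real.sinh x * Real.sinh x) / Real.cosh x ^ 2) x := by
    rw [e]; exact h
  convert h2 using 1
  rw [Real.tanh_eq_sinh_div_cosh]; field_simp

theorem ql0_d (a b x : ℝ) (h : Real.tanh x ≠ 0) :
    HasDerivAt (fun s => ql0 a b (Real.tanh s)) (ql1 a b (Real.tanh x)) x := by
  have ht := hasDerivAt_tanh_aux x
  have := ((((hasDerivAt_const x a).div (ht.pow 2) (pow_ne_zero 2 h)).add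
    ((ht.pow 2).const_mul b)).sub_const a).sub_const b
  refine HasDerivAt.congr_deriv this ?_
  simp only [ql1, Pi.pow_apply]; field_simp; ring

theorem ql1_d (a b x : ℝ) (h : Real.tanh x ≠ 0) :
    HasDerivAt (fun s => ql1 a b (Real.tanh s)) (ql2 a b (Real.tanh x)) x := by
  have ht := hasDerivAt_tanh_aux x
  have := ((ht.pow 2).const_sub 1).mul (((hasDerivAt_const x (-2 * a)).div (ht.pow 3) (pow_ne_zero 3 h)).add
    (ht.const_mul (2 * b)))
  refine HasDerivAt.congr_deriv this ?_
  simp only [ql2, Pi.pow_apply, Pi.add_apply, Pi.div_apply]; field_simp; ring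

theorem ql2_d (a b x : ℝ) (h : Real.tanh x ≠ 0) :
    HasDerivAt (fun s => ql2 a b (Real.tanh s)) (ql3 a b (Real.tanh x)) x := by
  have ht := hasDerivAt_tanh_aux x
  have := ((ht.pow 2).const_sub 1).mul (((((hasDerivAt_const x (6 * a)).div (ht.pow 4) (pow_ne_zero 4 h)).sub
    ((hasDerivAt_const x (2 * a)).div (ht.pow 2) (pow_ne_zero 2 h))).add_const (2 * b)).sub
    ((ht.pow 2).const_mul (6 * b)))
  refine HasDerivAt.congr_deriv this ?_
  simp only [ql3, Pi.pow_apply, Pi.add_apply, Pi.sub_apply, Pi.div_apply]; field_simp; ring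

theorem tanh_pos_aux {x : ℝ} (hx : 0 < x) : 0 < Real.tanh x := by
  rw [Real.tanh_eq_sinh_div_cosh]
  exact div_pos (Real.sinh_pos_iff.2 hx) (Real.cosh_pos x)

theorem Lfun_eq (k n : ℕ) {x : ℝ} (hx : 0 < x) :
    Lfun k n x = ql0 ((k : ℝ) * n - 1) ((k : ℝ) - 1) (Real.tanh x) := by
  have hs := (Real.sinh_pos_iff.2 hx).ne'
  have hc := (Real.cosh_pos x).ne'
  have h := Real.cosh_sq x
  unfold Lfun ql0
  rw [Real.tanh_eq_sinh_div_cosh]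
  generalize (k : ℝ) * n - 1 = a
  generalize (k : ℝ) - 1 = b
  field_simp
  have h4 : Real.cosh x ^ 4 = (Real.sinh x ^ 2 + 1) ^ 2 := by rw [← h]; ring
  ring_nf
  rw [h4, h]; ring

theorem Hfun_eq (k n : ℕ) {x : ℝ} (hx : 0 < x) :
    Hfun k n x = ((k : ℝ) * n - 1) / Real.tanh x + ((k : ℝ) - 1) * Real.tanh x := by
  have hs := (Real.sinh_pos_iff.2 hx).ne'
  have hc := (Real.cosh_pos x).ne'
  unfold Hfun
  rw [Real.tanh_eq_sinh_div_cosh]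
  field_simp

theorem Lfun_deriv (k n : ℕ) {x : ℝ} (hx : 0 < x) :
    deriv (Lfun k n) x = ql1 ((k : ℝ) * n - 1) ((k : ℝ) - 1) (Real.tanh x) := by
  have h := ql0_d ((k : ℝ) * n - 1) ((k : ℝ) - 1) x (tanh_pos_aux hx).ne'
  refine (h.congr_of_eventuallyEq ?_).deriv
  filter_upwards [lt_mem_nhds hx] with s hs using Lfun_eq k n hs

noncomputable def zx0 (a b d y C s : ℝ) : ℝ :=
  -(y * (1 - y ^ 2) / 2) / s ^ 2 + 2 * ql0 a b (Real.tanh s) + s * ql1 a b (Real.tanh s)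
    + s ^ 2 * (ql0 a b (Real.tanh s) - d) ^ 2 / (2 * y)
    - y / 2 * ql0 (a ^ 2) (b ^ 2) (Real.tanh s) + C
noncomputable def zx1 (a b d y s : ℝ) : ℝ :=
  y * (1 - y ^ 2) / s ^ 3 + 3 * ql1 a b (Real.tanh s) + s * ql2 a b (Real.tanh s)
    + (s * (ql0 a b (Real.tanh s) - d) ^ 2
      + s ^ 2 * ((ql0 a b (Real.tanh s) - d) * ql1 a b (Real.tanh s))) / y
    - y / 2 * ql1 (a ^ 2) (b ^ 2) (Real.tanh s)
noncomputable def zx2 (a b d y s : ℝ) : ℝ :=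
  -(3 * (y * (1 - y ^ 2))) / s ^ 4 + 4 * ql2 a b (Real.tanh s) + s * ql3 a b (Real.tanh s)
    + ((ql0 a b (Real.tanh s) - d) ^ 2
      + 4 * s * ((ql0 a b (Real.tanh s) - d) * ql1 a b (Real.tanh s))
      + s ^ 2 * (ql1 a b (Real.tanh s) ^ 2
        + (ql0 a b (Real.tanh s) - d) * ql2 a b (Real.tanh s))) / y
    - y / 2 * ql2 (a ^ 2) (b ^ 2) (Real.tanh s)

theorem zx0_d (a b d y C : ℝ) (hy : y ≠ 0) {s : ℝ} (hs : 0 < s) :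
    HasDerivAt (zx0 a b d y C) (zx1 a b d y s) s := by
  have ht := (tanh_pos_aux hs).ne'
  have h0 := ql0_d a b s ht
  have h1 := ql1_d a b s ht
  have g0 := ql0_d (a ^ 2) (b ^ 2) s ht
  have hi := hasDerivAt_id' s
  have hs' := hs.ne'
  have := ((((((hasDerivAt_const s (-(y * (1 - y ^ 2) / 2))).div (hi.pow 2) (pow_ne_zero 2 hs')).add
    (h0.const_mul 2)).add (hi.mul h1)).add
    (((hi.pow 2).mul ((h0.sub_const d).pow 2)).div_const (2 * y))).sub
    (g0.const_mul (y / 2))).add_const C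
  refine HasDerivAt.congr_deriv this ?_
  simp only [zx1, Pi.pow_apply]
  generalize ql0 a b (Real.tanh s) = l0
  generalize ql1 a b (Real.tanh s) = l1
  generalize ql2 a b (Real.tanh s) = l2
  generalize ql1 (a ^ 2) (b ^ 2) (Real.tanh s) = l1
  field_simp; ring

theorem zx1_d (a b d y : ℝ) (hy : y ≠ 0) {s : ℝ} (hs : 0 < s) :
    HasDerivAt (zx1 a b d y) (zx2 a b d y s) s := by
  have ht := (tanh_pos_aux hs).ne'
  have h0 := ql0_d a b s ht
  have h1 := ql1_d a b s ht
  have h2 := ql2_d a b s ht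
  have g1 := ql1_d (a ^ 2) (b ^ 2) s ht
  have hi := hasDerivAt_id' s
  have hs' := hs.ne'
  have := (((((hasDerivAt_const s (y * (1 - y ^ 2))).div (hi.pow 3) (pow_ne_zero 3 hs')).add
    (h1.const_mul 3)).add (hi.mul h2)).add
    (((hi.mul ((h0.sub_const d).pow 2)).add ((hi.pow 2).mul ((h0.sub_const d).mul h1))).div_const y)).sub
    (g1.const_mul (y / 2))
  refine HasDerivAt.congr_deriv this ?_
  simp only [zx2, Pi.pow_apply, Pi.mul_apply]
  generalize ql0 a b (Real.tanh s) = l0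
  generalize ql1 a b (Real.tanh s) = l1
  generalize ql2 a b (Real.tanh s) = l2
  generalize ql3 a b (Real.tanh s) = l3
  generalize ql2 (a ^ 2) (b ^ 2) (Real.tanh s) = l1
  field_simp; ring

theorem Zfun_eq (k n : ℕ) (lam1 lam2 y : ℝ) (hy : y ≠ 0) : ∃ C : ℝ, ∀ s : ℝ, 0 < s →
    Zfun k n lam1 lam2 s y =
      zx0 ((k : ℝ) * n - 1) ((k : ℝ) - 1) (lam2 - lam1) y C s := by
  refine ⟨2 * lam1 * y - (lam2 - lam1) - (1 - y) * (lam2 - lam1)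
    - y / 2 * (((k : ℝ) * n - 1) + ((k : ℝ) - 1)) ^ 2, fun s hs => ?_⟩
  unfold Zfun Sfun
  rw [Lfun_deriv k n hs, Lfun_eq k n hs, Hfun_eq k n hs]
  have ht := (tanh_pos_aux hs).ne'
  unfold zx0
  generalize (k : ℝ) * n - 1 = a
  generalize (k : ℝ) - 1 = b
  have e : ql0 (a ^ 2) (b ^ 2) (Real.tanh s) =
    (a / Real.tanh s + b * Real.tanh s) ^ 2 - (a ^ 2 + b ^ 2 + 2 * a * b) := by
    unfold ql0; field_simp; ring
  rw [e]
  generalize (a / Real.tanh s + b * Real.tanh s) = H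
  generalize ql0 a b (Real.tanh s) = l0
  generalize ql1 a b (Real.tanh s) = l1
  have hs' := hs.ne'
  field_simp; ring

theorem tanh_facts {x : ℝ} (hx : 0 < x) : 0 < Real.tanh x ^ 2 ∧ Real.tanh x ^ 2 < 1 := by
  have h := tanh_pos_aux hx
  have h1 := Real.tanh_lt_one x
  constructor <;> nlinarith

theorem tanh_sq_lt (x : ℝ) : Real.tanh x ^ 2 < 1 := by
  have h := Real.neg_one_lt_tanh x
  have h1 := Real.tanh_lt_one x
  nlinarith

theorem pade_low {x : ℝ} (hx : 0 < x) :
    Real.tanh x * (105 - 55 * Real.tanh x ^ 2) ≤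
      x * (105 - 90 * Real.tanh x ^ 2 + 9 * (Real.tanh x ^ 2) ^ 2) := by
  have hM : ∀ u : ℝ, 0 < 105 - 90 * Real.tanh u ^ 2 + 9 * (Real.tanh u ^ 2) ^ 2 := by
    intro u
    nlinarith [tanh_sq_lt u, sq_nonneg (Real.tanh u ^ 2)]
  have hd : ∀ u : ℝ, HasDerivAt (fun u => u - Real.tanh u * (105 - 55 * Real.tanh u ^ 2) /
      (105 - 90 * Real.tanh u ^ 2 + 9 * (Real.tanh u ^ 2) ^ 2))
      (576 * Real.tanh u ^ 8 / (105 - 90 * Real.tanh u ^ 2 + 9 * (Real.tanh u ^ 2) ^ 2) ^ 2) u := by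
    intro u
    have ht := hasDerivAt_tanh_aux u
    have hz := ht.pow 2
    have := (hasDerivAt_id' u).sub ((ht.mul ((hz.const_mul 55).const_sub 105)).div
      (((hz.const_mul 90).const_sub 105).add ((hz.pow 2).const_mul 9)) (hM u).ne')
    refine HasDerivAt.congr_deriv this ?_
    have := (hM u).ne'
    simp only [Pi.pow_apply, Pi.add_apply, Pi.mul_apply]
    rw [eq_comm, eq_sub_iff_add_eq, ← add_div, div_eq_one_iff_eq (pow_ne_zero 2 this)]
    ring
  have hm := monotone_of_deriv_nonneg (fun u => (hd u).differentiableAt)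
    (fun u => by rw [(hd u).deriv]; positivity)
  have h := hm hx.le
  simp only [Real.tanh_zero] at h
  norm_num at h
  rwa [div_le_iff₀ (hM x)] at h

theorem pade_up {x : ℝ} (hx : 0 < x) :
    x * (15 * (21 - 35 * Real.tanh x ^ 2 + 15 * (Real.tanh x ^ 2) ^ 2 - (Real.tanh x ^ 2) ^ 3)) ≤
    Real.tanh x * (315 - 420 * Real.tanh x ^ 2 + 113 * (Real.tanh x ^ 2) ^ 2) := by
  have hM : ∀ u : ℝ, 0 < 15 * (21 - 35 * Real.tanh u ^ 2 + 15 * (Real.tanh u ^ 2) ^ 2 - (Real.tanh u ^ 2) ^ 3) := by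
    intro u
    have h1 : 0 < 1 - Real.tanh u ^ 2 := by linarith [tanh_sq_lt u]
    have h2 : 0 < 21 - 14 * Real.tanh u ^ 2 + (Real.tanh u ^ 2) ^ 2 := by
      nlinarith [sq_nonneg (Real.tanh u ^ 2)]
    nlinarith [mul_pos h1 h2]
  have hd : ∀ u : ℝ, HasDerivAt (fun u => Real.tanh u * (315 - 420 * Real.tanh u ^ 2 + 113 * (Real.tanh u ^ 2) ^ 2) /
      (15 * (21 - 35 * Real.tanh u ^ 2 + 15 * (Real.tanh u ^ 2) ^ 2 - (Real.tanh u ^ 2) ^ 3)) - u)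
      (1920 * Real.tanh u ^ 10 * (1 - Real.tanh u ^ 2) / (15 * (21 - 35 * Real.tanh u ^ 2 + 15 * (Real.tanh u ^ 2) ^ 2 - (Real.tanh u ^ 2) ^ 3)) ^ 2) u := by
    intro u
    have ht := hasDerivAt_tanh_aux u
    have hz := ht.pow 2
    have := ((ht.mul (((hz.const_mul 420).const_sub 315).add ((hz.pow 2).const_mul 113))).div
      (((((hz.const_mul 35).const_sub 21).add ((hz.pow 2).const_mul 15)).sub (hz.pow 3)).const_mul 15) (hM u).ne').sub (hasDerivAt_id' u)
    refine HasDerivAt.congr_deriv this ?_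
    have := (hM u).ne'
    simp only [Pi.pow_apply, Pi.add_apply, Pi.sub_apply, Pi.mul_apply]
    rw [sub_eq_iff_eq_add, ← sub_eq_iff_eq_add', ← sub_div, div_eq_one_iff_eq (pow_ne_zero 2 this)]
    ring
  have hm := monotone_of_deriv_nonneg (fun u => (hd u).differentiableAt)
    (fun u => by
      rw [(hd u).deriv]
      have h1 : 0 < 1 - Real.tanh u ^ 2 := by linarith [tanh_sq_lt u]
      positivity)
  have h := hm hx.le
  simp only [Real.tanh_zero] at h
  norm_num at h
  rwa [le_div_iff₀ (by have := hM x; linarith)] at h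

theorem tanh_small {x : ℝ} (hx : 0 < x) (h : x < 2.1) : Real.tanh x ^ 2 ≤ 0.942 := by
  have e1 : Real.exp 2.1 ≤ 8.17 := by
    have h10 : Real.exp 2.1 ^ 10 ≤ 8.17 ^ 10 := by
      rw [← Real.exp_nat_mul]
      have : ((10 : ℕ) : ℝ) * 2.1 = ((21 : ℕ) : ℝ) * 1 := by norm_num
      rw [this, Real.exp_nat_mul]
      calc Real.exp 1 ^ 21 ≤ 2.7182818286 ^ 21 :=
            pow_le_pow_left₀ (Real.exp_pos 1).le Real.exp_one_lt_d9.le 21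
        _ ≤ 8.17 ^ 10 := by norm_num
    exact le_of_pow_le_pow_left₀ (by norm_num) (by norm_num) h10
  have e2 : 8 ≤ Real.exp 2.1 := by
    have h10 : (8 : ℝ) ^ 10 ≤ Real.exp 2.1 ^ 10 := by
      rw [← Real.exp_nat_mul]
      have : ((10 : ℕ) : ℝ) * 2.1 = ((21 : ℕ) : ℝ) * 1 := by norm_num
      rw [this, Real.exp_nat_mul]
      calc (8 : ℝ) ^ 10 ≤ 2.7182818283 ^ 21 := by norm_num
        _ ≤ _ := pow_le_pow_left₀ (by norm_num) Real.exp_one_gt_d9.le 21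
    exact le_of_pow_le_pow_left₀ (by norm_num) (Real.exp_pos _).le h10
  have hc : Real.cosh 2.1 ≤ 4.1475 := by
    rw [Real.cosh_eq, Real.exp_neg]
    have : (Real.exp 2.1)⁻¹ ≤ 8⁻¹ := inv_anti₀ (by norm_num) e2
    linarith
  have hcx : Real.cosh x ≤ 4.1475 := by
    refine le_trans (Real.cosh_le_cosh.2 ?_) hc
    rw [abs_of_pos hx, abs_of_pos (by norm_num)]; exact h.le
  have hp := Real.cosh_pos x
  rw [Real.tanh_eq_sinh_div_cosh, div_pow, div_le_iff₀ (by positivity)]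
  have := Real.cosh_sq x
  nlinarith

theorem ineq1_core {z v : ℝ} (hz0 : 0 < z) (hz1 : z < 1)
    (hlow : 105 - 55 * z ≤ v * (105 - 90 * z + 9 * z ^ 2))
    (hc : z ≤ 0.942 ∨ 2.1 ≤ v) (he : 0 ≤ v * (3 - z) - 3) (hv1 : 1 ≤ v) :
    0 < (v * (3 - z) - 3) * (v ^ 2 * (2 - z ^ 2) ^ 2 - z ^ 2)
      + 4 * z ^ 2 * (v ^ 3 * ((1 - z) * (4 - 3 * z ^ 2)) - 1) := by
  have hl1 : 1 ≤ 2 - z ^ 2 := by nlinarith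
  have hcons : ∀ v0 z1 E : ℝ, 1 ≤ v0 → v0 ≤ v → z ≤ z1 → z1 < 1 → 0 ≤ E → E ≤ v0 * (3 - z1) - 3 →
      0 < E * (v0 ^ 2 * (2 - z1 ^ 2) ^ 2 - z1 ^ 2)
      + 4 * z ^ 2 * (v0 ^ 3 * ((1 - z1) * (4 - 3 * z1 ^ 2)) - 1) →
      0 < (v * (3 - z) - 3) * (v ^ 2 * (2 - z ^ 2) ^ 2 - z ^ 2)
      + 4 * z ^ 2 * (v ^ 3 * ((1 - z) * (4 - 3 * z ^ 2)) - 1) := by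
    intro v0 z1 E hv0 hv hz hz1' hE hE2 h
    have hzz : z ^ 2 ≤ z1 ^ 2 := by nlinarith
    have hz11 : z1 ^ 2 < 1 := by nlinarith
    have h1 : E ≤ v * (3 - z) - 3 := by nlinarith
    have h2 : v0 ^ 2 * (2 - z1 ^ 2) ^ 2 ≤ v ^ 2 * (2 - z ^ 2) ^ 2 := by
      have a1 : v0 ^ 2 ≤ v ^ 2 := by nlinarith
      have a2 : (2 - z1 ^ 2) ^ 2 ≤ (2 - z ^ 2) ^ 2 := by nlinarith
      exact mul_le_mul a1 a2 (by positivity) (by positivity)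
    have h2' : 0 ≤ v0 ^ 2 * (2 - z1 ^ 2) ^ 2 - z1 ^ 2 := by
      have a1 : 1 ≤ v0 ^ 2 := by nlinarith
      have a2 : 1 ≤ (2 - z1 ^ 2) ^ 2 := by nlinarith
      nlinarith
    have h3 : v0 ^ 3 * ((1 - z1) * (4 - 3 * z1 ^ 2)) ≤ v ^ 3 * ((1 - z) * (4 - 3 * z ^ 2)) := by
      have a1 : v0 ^ 3 ≤ v ^ 3 := pow_le_pow_left₀ (by linarith) hv 3
      have a2 : (1 - z1) * (4 - 3 * z1 ^ 2) ≤ (1 - z) * (4 - 3 * z ^ 2) :=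
        mul_le_mul (by linarith) (by linarith) (by linarith) (by linarith)
      exact mul_le_mul a1 a2 (mul_nonneg (by linarith) (by linarith)) (by positivity)
    have h4 : E * (v0 ^ 2 * (2 - z1 ^ 2) ^ 2 - z1 ^ 2) ≤
      (v * (3 - z) - 3) * (v ^ 2 * (2 - z ^ 2) ^ 2 - z ^ 2) :=
      mul_le_mul h1 (by linarith) h2' he
    have h5 : 4 * z ^ 2 * (v0 ^ 3 * ((1 - z1) * (4 - 3 * z1 ^ 2)) - 1) ≤
      4 * z ^ 2 * (v ^ 3 * ((1 - z) * (4 - 3 * z ^ 2)) - 1) :=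
      mul_le_mul_of_nonneg_left (by linarith) (by positivity)
    linarith
  -- case without using the slope term
  have hcons0 : ∀ v0 z1 : ℝ, 1 ≤ v0 → v0 ≤ v → z ≤ z1 → z1 < 1 →
      1 < v0 ^ 3 * ((1 - z1) * (4 - 3 * z1 ^ 2)) →
      0 < (v * (3 - z) - 3) * (v ^ 2 * (2 - z ^ 2) ^ 2 - z ^ 2)
      + 4 * z ^ 2 * (v ^ 3 * ((1 - z) * (4 - 3 * z ^ 2)) - 1) := by
    intro v0 z1 hv0 hv hz hz1' h
    have hzz : z ^ 2 ≤ z1 ^ 2 := by nlinarith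
    have hz11 : z1 ^ 2 < 1 := by nlinarith
    have h3 : v0 ^ 3 * ((1 - z1) * (4 - 3 * z1 ^ 2)) ≤ v ^ 3 * ((1 - z) * (4 - 3 * z ^ 2)) := by
      have a1 : v0 ^ 3 ≤ v ^ 3 := pow_le_pow_left₀ (by linarith) hv 3
      have a2 : (1 - z1) * (4 - 3 * z1 ^ 2) ≤ (1 - z) * (4 - 3 * z ^ 2) :=
        mul_le_mul (by linarith) (by linarith) (by linarith) (by linarith)
      exact mul_le_mul a1 a2 (mul_nonneg (by linarith) (by linarith)) (by positivity)
    have h2' : 0 ≤ v ^ 2 * (2 - z ^ 2) ^ 2 - z ^ 2 := by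
      have a1 : 1 ≤ v ^ 2 := by nlinarith
      have a2 : 1 ≤ (2 - z ^ 2) ^ 2 := by nlinarith
      nlinarith
    have h5 : 0 < 4 * z ^ 2 * (v ^ 3 * ((1 - z) * (4 - 3 * z ^ 2)) - 1) :=
      mul_pos (by positivity) (by linarith)
    have := mul_nonneg he h2'
    linarith
  have hM : 0 < 105 - 90 * z + 9 * z ^ 2 := by nlinarith
  have hvlow : ∀ v0 : ℝ, v0 * (105 - 90 * z + 9 * z ^ 2) ≤ 105 - 55 * z → v0 ≤ v := by
    intro v0 h
    exact le_of_mul_le_mul_right (h.trans hlow) hM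
  rcases lt_or_ge v 2.1 with hv | hv
  · have hz942 : z ≤ 0.942 := by
      rcases hc with h | h
      · exact h
      · linarith
    rcases le_total z 0.6 with h6 | h6
    · exact hcons0 1 0.6 (by norm_num) hv1 h6 (by norm_num) (by norm_num)
    rcases le_total z 0.7 with h7 | h7
    · exact hcons0 1.3 0.7 (by norm_num) (hvlow _ (by nlinarith)) h7 (by norm_num) (by norm_num)
    rcases le_total z 0.8 with h8 | h8
    · exact hcons0 1.42 0.8 (by norm_num) (hvlow _ (by nlinarith)) h8 (by norm_num) (by norm_num)
    rcases le_total z 0.88 with h88 | h88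
    · refine hcons 1.57 0.88 0.32 (by norm_num) (hvlow _ (by nlinarith)) h88 (by norm_num) (by norm_num) (by norm_num) ?_
      norm_num; nlinarith
    rcases le_total z 0.92 with h92 | h92
    · refine hcons 1.72 0.92 0.57 (by norm_num) (hvlow _ (by nlinarith)) h92 (by norm_num) (by norm_num) (by norm_num) ?_
      norm_num; nlinarith
    · refine hcons 1.82 0.942 0.74 (by norm_num) (hvlow _ (by nlinarith)) hz942 (by norm_num) (by norm_num) (by norm_num) ?_
      norm_num; nlinarith
  · have hE : 1.2 ≤ v * (3 - z) - 3 := by nlinarith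
    have a2 : 1 ≤ (2 - z ^ 2) ^ 2 := by nlinarith
    have hz2 : z ^ 2 < 1 := by nlinarith
    have hA : 3.41 ≤ v ^ 2 * (2 - z ^ 2) ^ 2 - z ^ 2 := by
      have : 4.41 ≤ v ^ 2 := by nlinarith
      nlinarith
    have h5 : 0 ≤ v ^ 3 * ((1 - z) * (4 - 3 * z ^ 2)) :=
      mul_nonneg (by positivity) (mul_nonneg (by linarith) (by linarith))
    have h6 : 1.2 * 3.41 ≤ (v * (3 - z) - 3) * (v ^ 2 * (2 - z ^ 2) ^ 2 - z ^ 2) :=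
      mul_le_mul hE hA (by norm_num) (by linarith)
    have h7 : 0 ≤ 4 * z ^ 2 * (v ^ 3 * ((1 - z) * (4 - 3 * z ^ 2))) := by positivity
    nlinarith

theorem ineq1 {z v a b : ℝ} (hz0 : 0 < z) (hz1 : z < 1) (hb : 0 < b) (hab : 2 * b ≤ a)
    (hlow : 105 - 55 * z ≤ v * (105 - 90 * z + 9 * z ^ 2))
    (hc : z ≤ 0.942 ∨ 2.1 ≤ v) (he : 0 ≤ v * (3 - z) - 3) (hv1 : 1 ≤ v)
    (hup : v * (1 - z) ≤ 1) :
    4 * v ^ 2 * ((a - b * z ^ 2) - b * v * z ^ 2 * (1 - z)) ^ 2 <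
      (1 + v * (3 - z)) * (v ^ 2 * (a - b * z ^ 2) ^ 2 - b ^ 2 * z ^ 2) := by
  have h := ineq1_core hz0 hz1 hlow hc he hv1
  obtain ⟨m, hm⟩ : ∃ m, m = a - b * z ^ 2 := ⟨_, rfl⟩
  have hml : b * (2 - z ^ 2) ≤ m := by rw [hm]; linarith
  rw [← hm]
  have hz2 : z ^ 2 < 1 := by nlinarith
  have hbl : 0 < b * (2 - z ^ 2) := by apply mul_pos hb; linarith
  have h1 : (v * (3 - z) - 3) * v ^ 2 * (b * (2 - z ^ 2)) ^ 2 ≤ (v * (3 - z) - 3) * v ^ 2 * m ^ 2 :=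
    mul_le_mul_of_nonneg_left (pow_le_pow_left₀ hbl.le hml 2) (by positivity)
  have h1z : 0 < 1 - z := by linarith
  have h2 : 8 * v ^ 3 * b * z ^ 2 * (1 - z) * (b * (2 - z ^ 2)) ≤ 8 * v ^ 3 * b * z ^ 2 * (1 - z) * m :=
    mul_le_mul_of_nonneg_left hml (by positivity)
  have h3 : 4 * v ^ 3 * b ^ 2 * z ^ 4 * (1 - z) * (v * (1 - z)) ≤ 4 * v ^ 3 * b ^ 2 * z ^ 4 * (1 - z) * 1 :=
    mul_le_mul_of_nonneg_left hup (by positivity)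
  have h4 := mul_pos (pow_pos hb 2) h
  nlinarith [h1, h2, h3, h4]

theorem ineq2 {z v a b : ℝ} (hz0 : 0 < z) (hz1 : z < 1) (hb : 0 < b) (hab : 2 * b ≤ a)
    (hup : v * (15 * (21 - 35 * z + 15 * z ^ 2 - z ^ 3)) ≤ 315 - 420 * z + 113 * z ^ 2) :
    0 ≤ ((3 - z) - v * (1 - z) * (3 + z)) * (a - b * z ^ 2) + 16 * b * z ^ 2 * (1 - z) * (1 - v * z) := by
  have hD : 0 < 15 * (21 - 14 * z + z ^ 2) := by nlinarith
  have hup' : (v * (1 - z)) * (15 * (21 - 14 * z + z ^ 2)) ≤ 315 - 420 * z + 113 * z ^ 2 := by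
    linarith [hup, (by ring : (v * (1 - z)) * (15 * (21 - 14 * z + z ^ 2)) = v * (15 * (21 - 35 * z + 15 * z ^ 2 - z ^ 3)))]
  obtain ⟨w, hw⟩ : ∃ w, w = v * (1 - z) := ⟨_, rfl⟩
  rw [← hw] at hup' ⊢
  have hq : 0 ≤ (3 - z) - w * (3 + z) := by
    refine nonneg_of_mul_nonneg_left (b := 15 * (21 - 14 * z + z ^ 2)) ?_ hD
    have h1 := mul_le_mul_of_nonneg_right hup' (by linarith : 0 ≤ 3 + z)
    have h2 : 0 ≤ z ^ 2 * (336 - 128 * z) := by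
      apply mul_nonneg (by positivity); linarith
    nlinarith
  have hz2 : z ^ 2 < 1 := by nlinarith
  have hr : 0 ≤ ((3 - z) - w * (3 + z)) * (2 - z ^ 2) + 16 * z ^ 2 * ((1 - z) - w * z) := by
    refine nonneg_of_mul_nonneg_left (b := 15 * (21 - 14 * z + z ^ 2)) ?_ hD
    have h1 := mul_le_mul_of_nonneg_right hup' (by
      have : 0 ≤ (3 + z) * (2 - z ^ 2) := mul_nonneg (by linarith) (by linarith)
      positivity : 0 ≤ (3 + z) * (2 - z ^ 2) + 16 * z ^ 3)
    have h3 : 0 ≤ 5712 - 13696 * z + 9984 * z ^ 2 - 1920 * z ^ 3 := by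
      nlinarith [mul_nonneg (by linarith : 0 ≤ 1 - z) (sq_nonneg (z - 0.93)), sq_nonneg (z - 0.93)]
    have h2 : 0 ≤ z ^ 2 * (5712 - 13696 * z + 9984 * z ^ 2 - 1920 * z ^ 3) := by positivity
    nlinarith
  have h5 := mul_nonneg hb.le hr
  have h6 := mul_nonneg hq (by linarith : 0 ≤ a - 2 * b)
  have : ((3 - z) - w * (3 + z)) * (a - b * z ^ 2) + 16 * b * z ^ 2 * (1 - z) * (1 - v * z)
    = b * (((3 - z) - w * (3 + z)) * (2 - z ^ 2) + 16 * z ^ 2 * ((1 - z) - w * z))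
      + ((3 - z) - w * (3 + z)) * (a - 2 * b) := by rw [hw]; ring
  rw [this]; linarith

theorem key {a b d y r : ℝ} (hr : 0 < r) (hb : 0 < b) (hab : 2 * b ≤ a) (hy0 : 0 < y) (hy1 : y < 1) :
    0 < zx2 a b d y r + ((3 - Real.tanh r ^ 2) / Real.tanh r) * zx1 a b d y r := by
  have ht := tanh_pos_aux hr
  obtain ⟨hz0, hz1⟩ := tanh_facts hr
  have hlow := pade_low hr
  have hup := pade_up hr
  have hc : Real.tanh r ^ 2 ≤ 0.942 ∨ 2.1 ≤ r := by
    rcases lt_or_ge r 2.1 with h | h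
    · exact Or.inl (tanh_small hr h)
    · exact Or.inr h
  have htl := Real.tanh_lt_one r
  unfold zx1 zx2
  generalize Real.tanh r = t at *
  obtain ⟨v, hv⟩ : ∃ v, v = r / t := ⟨_, rfl⟩
  have hrv : r = v * t := by rw [hv]; field_simp
  have hv0 : 0 < v := by rw [hv]; positivity
  clear hv
  subst hrv
  obtain ⟨z, hz⟩ : ∃ z, z = t ^ 2 := ⟨_, rfl⟩
  rw [← hz] at hlow hup hc hz0 hz1
  have hlow' : 105 - 55 * z ≤ v * (105 - 90 * z + 9 * z ^ 2) := by
    refine le_of_mul_le_mul_left ?_ ht; linarith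
  have hup' : v * (15 * (21 - 35 * z + 15 * z ^ 2 - z ^ 3)) ≤ 315 - 420 * z + 113 * z ^ 2 := by
    refine le_of_mul_le_mul_left ?_ ht; linarith
  have hc' : z ≤ 0.942 ∨ 2.1 ≤ v := by
    rcases hc with h | h
    · exact Or.inl h
    · right; nlinarith
  have hM : 0 < 105 - 90 * z + 9 * z ^ 2 := by nlinarith
  have he : 0 ≤ v * (3 - z) - 3 := by
    refine nonneg_of_mul_nonneg_left (b := 105 - 90 * z + 9 * z ^ 2) ?_ hM
    have := mul_le_mul_of_nonneg_right hlow' (by linarith : 0 ≤ 3 - z)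
    nlinarith [sq_nonneg z]
  have hv1 : 1 ≤ v := by nlinarith
  have hD : 0 < 15 * (21 - 14 * z + z ^ 2) := by nlinarith
  have hv2 : v * (1 - z) ≤ 1 := by
    refine le_of_mul_le_mul_right (a := 15 * (21 - 14 * z + z ^ 2)) ?_ hD
    nlinarith
  have i1 := ineq1 hz0 hz1 hb hab hlow' hc' he hv1 hv2
  have i2 := ineq2 hz0 hz1 hb hab hup'
  -- the quadratic in L
  obtain ⟨L, hL⟩ : ∃ L, L = ql0 a b t - d := ⟨_, rfl⟩
  rw [← hL]
  obtain ⟨m, hm⟩ : ∃ m, m = a - b * z ^ 2 := ⟨_, rfl⟩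
  rw [← hm] at i1 i2
  have hK : 0 < 1 + v * (3 - z) := by linarith
  have hy2 : y ^ 2 < 1 := by nlinarith
  have hquad : 0 < (1 + v * (3 - z)) * L ^ 2 - 8 * L * v / z * (1 - z) * (m - b * v * z ^ 2 * (1 - z))
      + 4 * (1 - z) ^ 2 * (v ^ 2 * m ^ 2 - y ^ 2 * b ^ 2 * z ^ 2) / z ^ 2 := by
    have h1z : 0 < 1 - z := by linarith
    have e : (1 + v * (3 - z)) * ((1 + v * (3 - z)) * L ^ 2 - 8 * L * v / z * (1 - z) * (m - b * v * z ^ 2 * (1 - z))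
      + 4 * (1 - z) ^ 2 * (v ^ 2 * m ^ 2 - y ^ 2 * b ^ 2 * z ^ 2) / z ^ 2)
      = ((1 + v * (3 - z)) * L - 4 * v / z * (1 - z) * (m - b * v * z ^ 2 * (1 - z))) ^ 2
       + 4 * (1 - z) ^ 2 / z ^ 2 * ((1 + v * (3 - z)) * (v ^ 2 * m ^ 2 - b ^ 2 * z ^ 2)
          - 4 * v ^ 2 * (m - b * v * z ^ 2 * (1 - z)) ^ 2)
       + 4 * (1 - z) ^ 2 * ((1 + v * (3 - z)) * (b ^ 2 * (1 - y ^ 2))) := by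
      field_simp; ring
    refine pos_of_mul_pos_right (a := 1 + v * (3 - z)) ?_ hK.le
    rw [e]
    have p1 : 0 < 4 * (1 - z) ^ 2 / z ^ 2 * ((1 + v * (3 - z)) * (v ^ 2 * m ^ 2 - b ^ 2 * z ^ 2)
          - 4 * v ^ 2 * (m - b * v * z ^ 2 * (1 - z)) ^ 2) := by
      apply mul_pos (by positivity); linarith
    have p2 : 0 ≤ 4 * (1 - z) ^ 2 * ((1 + v * (3 - z)) * (b ^ 2 * (1 - y ^ 2))) := by
      have : 0 < 1 - y ^ 2 := by linarith
      positivity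
    positivity
  have hT2 : 0 ≤ 2 * (1 - z) / z ^ 2 * (((3 - z) - v * (1 - z) * (3 + z)) * m + 16 * b * z ^ 2 * (1 - z) * (1 - v * z)) := by
    have h1z : 0 < 1 - z := by linarith
    exact mul_nonneg (by positivity) i2
  have hT4 : 0 ≤ y * (1 - y ^ 2) * (v * (3 - z) - 3) / (v ^ 4 * z ^ 2) := by
    have : 0 < 1 - y ^ 2 := by linarith
    positivity
  have hfin := add_pos_of_pos_of_nonneg (add_pos_of_pos_of_nonneg (div_pos hquad hy0) hT2) hT4
  refine lt_of_lt_of_eq hfin ?_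
  clear hfin hT4 hT2 hquad i1 i2 hlow hup hlow' hup' hL hc hc'
  rw [hm, hz]
  unfold ql1 ql2 ql3
  have hy := hy0.ne'
  have ht' := ht.ne'
  have hv' := hv0.ne'
  field_simp
  ring

theorem stmt_10
    (k n : ℕ) (hk : k = 2 ∨ k = 4 ∨ k = 8) (hn : 2 ≤ n) (hk8 : k = 8 → n = 2)
    (lam1 lam2 : ℝ) (hlam : lam1 < lam2) :
    ¬ ∃ r y : ℝ, 0 < r ∧ 0 < y ∧ y < 1 ∧
      deriv (fun s => Zfun k n lam1 lam2 s y) r = 0 ∧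
      deriv (deriv (fun s => Zfun k n lam1 lam2 s y)) r ≤ 0 := by
  rintro ⟨r, y, hr, hy0, hy1, h1, h2⟩
  obtain ⟨C, hC⟩ := Zfun_eq k n lam1 lam2 y hy0.ne'
  have hk2 : (2 : ℝ) ≤ k := by
    have : 2 ≤ k := by omega
    exact_mod_cast this
  have hn2 : (2 : ℝ) ≤ n := by exact_mod_cast hn
  have hd1 : ∀ s : ℝ, 0 < s → deriv (fun s => Zfun k n lam1 lam2 s y) s =
      zx1 ((k : ℝ) * n - 1) ((k : ℝ) - 1) (lam2 - lam1) y s := by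
    intro s hs
    refine ((zx0_d _ _ _ y C hy0.ne' hs).congr_of_eventuallyEq ?_).deriv
    filter_upwards [lt_mem_nhds hs] with u hu using hC u hu
  have hd2 : deriv (deriv (fun s => Zfun k n lam1 lam2 s y)) r =
      zx2 ((k : ℝ) * n - 1) ((k : ℝ) - 1) (lam2 - lam1) y r := by
    refine ((zx1_d _ _ _ y hy0.ne' hr).congr_of_eventuallyEq ?_).deriv
    filter_upwards [lt_mem_nhds hr] with u hu using hd1 u hu
  have hkey := key (a := (k : ℝ) * n - 1) (b := (k : ℝ) - 1) (d := lam2 - lam1) hr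
    (by linarith) (by nlinarith) hy0 hy1
  rw [← hd1 r hr, h1, mul_zero, add_zero, ← hd2] at hkey
  linarith
end

section
/- The first two Dirichlet eigenvalues of a geodesic ball in 𝕂ℍⁿ satisfy λ₂/(kn+2) − λ₁/(kn) ≥ −(2kn + 3k − 1)/(3(kn+2)). -/
lemma aux_nonneg (F F' : ℝ → ℝ) (R : ℝ)
    (hd : ∀ r : ℝ, 0 < r → HasDerivAt F (F' r) r)
    (hp : ∀ r ∈ Set.Ioo (0:ℝ) R, 0 ≤ F' r)
    (hl : Filter.Tendsto F (nhdsWithin 0 (Set.Ioi 0)) (nhds 0)) :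
    ∀ r ∈ Set.Ioc (0:ℝ) R, 0 ≤ F r := by
  intro r hr
  have hmono : MonotoneOn F (Set.Ioc 0 R) := by
    apply monotoneOn_of_deriv_nonneg (convex_Ioc 0 R)
    · intro x hx
      exact (hd x hx.1).continuousAt.continuousWithinAt
    · intro x hx
      rw [interior_Ioc] at hx
      exact (hd x hx.1).differentiableAt.differentiableWithinAt
    · intro x hx
      rw [interior_Ioc] at hx
      rw [(hd x hx.1).deriv]
      exact hp x hx
  apply le_of_tendsto hl
  filter_upwards [Ioo_mem_nhdsGT hr.1] with x hx
  exact hmono ⟨hx.1, hx.2.le.trans hr.2⟩ hr hx.2.le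

lemma aux_tanh (r : ℝ) : HasDerivAt Real.tanh (1 - Real.tanh r ^ 2) r := by
  have hC := (Real.cosh_pos r).ne'
  have h := (Real.hasDerivAt_sinh r).div (Real.hasDerivAt_cosh r) hC
  have e : (Real.sinh / Real.cosh) = Real.tanh := by
    funext x; simp [Real.tanh_eq_sinh_div_cosh]
  rw [e] at h
  refine h.congr_deriv ?_
  rw [Real.tanh_eq_sinh_div_cosh]
  field_simp

lemma aux_tanh_sq (r : ℝ) : Real.tanh r ^ 2 < 1 := by
  have h := Real.cosh_sq r
  have hC := Real.cosh_pos r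
  rw [Real.tanh_eq_sinh_div_cosh, div_pow, div_lt_one (by positivity)]
  linarith

lemma aux_mu (N j : ℕ) (r : ℝ) (hr : 0 < r) :
    HasDerivAt (fun x => Real.sinh x ^ (N+1) * Real.cosh x ^ (j+1))
      (((N+1:ℝ) / Real.tanh r + (j+1:ℝ) * Real.tanh r) *
        (Real.sinh r ^ (N+1) * Real.cosh r ^ (j+1))) r := by
  have hC := (Real.cosh_pos r).ne'
  have hS := (Real.sinh_pos_iff.2 hr).ne'
  have h := ((Real.hasDerivAt_sinh r).pow (N+1)).mul ((Real.hasDerivAt_cosh r).pow (j+1))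
  refine h.congr_deriv ?_
  rw [Real.tanh_eq_sinh_div_cosh]
  simp only [Nat.add_sub_cancel, Pi.pow_apply]
  push_cast
  field_simp
  ring

lemma aux_w (N j : ℕ) (r : ℝ) (hr : 0 < r) :
    HasDerivAt (fun x => Real.sinh x ^ (N+1) * Real.cosh x ^ (j+1) * Real.cosh x ^ (-(3/4) : ℝ))
      (((N+1:ℝ) / Real.tanh r + (j+1:ℝ) * Real.tanh r - 3/4 * Real.tanh r) *
        (Real.sinh r ^ (N+1) * Real.cosh r ^ (j+1) * Real.cosh r ^ (-(3/4) : ℝ))) r := by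
  have hC := (Real.cosh_pos r)
  have h := (aux_mu N j r hr).mul
    ((Real.hasDerivAt_cosh r).rpow_const (p := (-(3/4) : ℝ)) (Or.inl hC.ne'))
  refine h.congr_deriv ?_
  rw [Real.rpow_sub_one hC.ne', Real.tanh_eq_sinh_div_cosh]
  field_simp
  ring

/-- the key algebraic inequality -/
lemma aux_alg (k m K D ν x z zx : ℝ) (hx0 : 0 ≤ x) (hx1 : x < 1)
    (hkm : (k = 2 ∧ 4 ≤ m) ∨ (k = 4 ∧ 8 ≤ m) ∨ (k = 8 ∧ m = 16))
    (hK : K = 7/8 * (k - 7/4)) (hD : D = (5*m - 12*k + 38)/24)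
    (hz : z * (1 - 3/4 * x) = ν - D - K * x)
    (hzx : zx * (1 - 3/4 * x) = 3/4 * z - K) :
    0 ≤ m * (ν - z) + x * (z^2 - (k-2) * z) - 2 * x * (1-x) * zx := by
  have hν : ν - z = D + K * x - 3/4 * x * z := by linarith
  have hm : 4 ≤ m := by rcases hkm with h | h | h <;> linarith [h.2]
  have hD0 : 0 ≤ D := by
    rcases hkm with h | h | h <;> rw [hD, h.1] <;> linarith [h.2]
  have hA : 0 ≤ m * D + (z^2 - (k-2) * z + m * K - 3/4 * m * z) - 2 * (3/4 * z - K) := by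
    rcases hkm with h | h | h
    · obtain ⟨rfl, h⟩ := h
      subst hK hD
      nlinarith [sq_nonneg (z - 3/8 * (m+2))]
    · obtain ⟨rfl, h⟩ := h
      subst hK hD
      nlinarith [sq_nonneg (z - 1 - 3/8 * (m+2))]
    · obtain ⟨rfl, rfl⟩ := h
      subst hK hD
      nlinarith [sq_nonneg (z - 3 - 3/8 * (16+2))]
  have hB : 0 ≤ m * D + (z^2 - (k-2) * z + m * K - 3/4 * m * z) := by
    rcases hkm with h | h | h
    · obtain ⟨rfl, h⟩ := h
      subst hK hD
      nlinarith [sq_nonneg (z - 3/8 * m)]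
    · obtain ⟨rfl, h⟩ := h
      subst hK hD
      nlinarith [sq_nonneg (z - 1 - 3/8 * m)]
    · obtain ⟨rfl, rfl⟩ := h
      subst hK hD
      nlinarith [sq_nonneg (z - 3 - 3/8 * 16)]
  have hmD : 0 ≤ m * D * (1 - x) := by
    have : 0 ≤ 1 - x := by linarith
    positivity
  have hden : 0 < 1 - 3/4 * x := by linarith
  rw [hν]
  rcases le_total 0 zx with h0 | h0
  · have h1 : (1-x) * zx ≤ 3/4 * z - K := by nlinarith [mul_nonneg hx0 h0]
    nlinarith [mul_nonneg hx0 hA, mul_nonneg hx0 (sub_nonneg.2 h1)]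
  · have h1 : 0 ≤ x * (1-x) * (-zx) := by
      have : 0 ≤ 1 - x := by linarith
      have : 0 ≤ -zx := by linarith
      positivity
    nlinarith [mul_nonneg hx0 hB]

/-- The first two Dirichlet eigenvalues of a geodesic ball in 𝕂ℍⁿ
satisfy λ₂/(kn+2) − λ₁/(kn) ≥ −(2kn + 3k − 1)/(3(kn+2)). -/
theorem stmt_12
    (k n : ℕ) (hk : k = 2 ∨ k = 4 ∨ k = 8) (hn : 2 ≤ n) (hk8 : k = 8 → n = 2)
    (H : ℝ → ℝ)
    (hH : ∀ r : ℝ, 0 < r →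
      H r = ((k : ℝ) * n - 1) * (Real.cosh r / Real.sinh r) + ((k : ℝ) - 1) * Real.tanh r)
    (R lam1 : ℝ) (hR : 0 < R) (hlam1 : 0 < lam1)
    (g₁ g₁' g₁'' : ℝ → ℝ)
    (hg₁d : ∀ r : ℝ, 0 < r → HasDerivAt g₁ (g₁' r) r)
    (hg₁d' : ∀ r : ℝ, 0 < r → HasDerivAt g₁' (g₁'' r) r)
    (hg₁c : ContinuousOn g₁'' (Set.Ioi 0))
    (hg₁ode : ∀ r : ℝ, 0 < r → g₁'' r + H r * g₁' r + lam1 * g₁ r = 0)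
    (hg₁pos : ∀ r ∈ Set.Ioo (0 : ℝ) R, 0 < g₁ r)
    (hg₁R : g₁ R = 0)
    (hg₁lim : Filter.Tendsto g₁ (nhdsWithin 0 (Set.Ioi 0)) (nhds 1))
    (hg₁'lim : Filter.Tendsto g₁' (nhdsWithin 0 (Set.Ioi 0)) (nhds 0))
    (Λ : ℝ → ℝ)
    (hΛ : ∀ r : ℝ, 0 < r →
      Λ r = ((k : ℝ) * n - 1) / Real.sinh r ^ 2 - ((k : ℝ) - 1) / Real.cosh r ^ 2)
    (lam2 : ℝ)
    (g₂ g₂' g₂'' : ℝ → ℝ)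
    (hg₂d : ∀ r : ℝ, 0 < r → HasDerivAt g₂ (g₂' r) r)
    (hg₂d' : ∀ r : ℝ, 0 < r → HasDerivAt g₂' (g₂'' r) r)
    (hg₂c : ContinuousOn g₂'' (Set.Ioi 0))
    (hg₂ode : ∀ r : ℝ, 0 < r → g₂'' r + H r * g₂' r + (lam2 - Λ r) * g₂ r = 0)
    (hg₂pos : ∀ r ∈ Set.Ioo (0 : ℝ) R, 0 < g₂ r)
    (hg₂R : g₂ R = 0)
    (hg₂lim : Filter.Tendsto (fun r => g₂ r / r) (nhdsWithin 0 (Set.Ioi 0)) (nhds 1))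
    (hg₂'lim : Filter.Tendsto g₂' (nhdsWithin 0 (Set.Ioi 0)) (nhds 1))
    (hubar1 : ∃ v : ℝ → ℝ, ContDiffOn ℝ 1 v (Set.Icc 0 R) ∧
      (∀ r ∈ Set.Ioo (0 : ℝ) R,
        v r = Real.sinh r ^ (((k : ℝ) * n - 1) / 2) * Real.cosh r ^ (((k : ℝ) - 1) / 2) * g₁ r) ∧
      v 0 = 0 ∧ v R = 0)
    (hubar2 : ∃ v : ℝ → ℝ, ContDiffOn ℝ 1 v (Set.Icc 0 R) ∧
      (∀ r ∈ Set.Ioo (0 : ℝ) R,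
        v r = Real.sinh r ^ (((k : ℝ) * n - 1) / 2) * Real.cosh r ^ (((k : ℝ) - 1) / 2) * g₂ r) ∧
      v 0 = 0 ∧ v R = 0) :
    -(2 * ((k : ℝ) * n) + 3 * k - 1) / (3 * ((k : ℝ) * n + 2)) ≤
      lam2 / ((k : ℝ) * n + 2) - lam1 / ((k : ℝ) * n) := by
  by_contra hcon
  push Not at hcon
  clear hubar1 hubar2 hg₁c hg₂c
  obtain ⟨N, hN⟩ : ∃ N : ℕ, k * n = N + 2 := ⟨k * n - 2, by
    have : 4 ≤ k * n := by rcases hk with h | h | h <;> subst h <;> omega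
    omega⟩
  obtain ⟨j, hj⟩ : ∃ j : ℕ, k = j + 2 := ⟨k - 2, by omega⟩
  have hkm : ((k:ℝ) = 2 ∧ (4:ℝ) ≤ (k:ℝ) * n) ∨ ((k:ℝ) = 4 ∧ (8:ℝ) ≤ (k:ℝ) * n) ∨
      ((k:ℝ) = 8 ∧ (k:ℝ) * n = 16) := by
    have hn' : (2:ℝ) ≤ n := by exact_mod_cast hn
    rcases hk with h | h | h
    · left; subst h; push_cast; constructor <;> linarith
    · right; left; subst h; push_cast; constructor <;> linarith
    · right; right
      have := hk8 h
      subst this; subst h; norm_num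
  have hNm : (k:ℝ) * n = N + 2 := by exact_mod_cast hN
  have hjk : (k:ℝ) = j + 2 := by exact_mod_cast hj
  generalize hm : (k:ℝ) * n = m at *
  generalize hκ : (k:ℝ) = κ at *
  have hm4 : 4 ≤ m := by rcases hkm with h | h | h <;> linarith [h.2]
  obtain ⟨ν, hν⟩ : ∃ ν : ℝ, lam1 = m * ν := ⟨lam1 / m, by field_simp⟩
  have hcon' : lam2 < (m + 2) * ν - (2 * m + 3 * κ - 1) / 3 := by
    rw [hν] at hcon
    have e1 : m * ν / m = ν := by field_simp
    rw [e1] at hcon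
    have h3 : lam2 / (m+2) < ν + -(2 * m + 3 * κ - 1) / (3 * (m + 2)) := by linarith
    rw [div_lt_iff₀ (by linarith)] at h3
    have e2 : (ν + -(2 * m + 3 * κ - 1) / (3 * (m + 2))) * (m+2)
      = (m + 2) * ν - (2 * m + 3 * κ - 1) / 3 := by field_simp; ring
    linarith
  have hHt : ∀ r : ℝ, 0 < r → H r = (m - 1) / Real.tanh r + (κ - 1) * Real.tanh r := by
    intro r hr
    rw [hH r hr, Real.tanh_eq_sinh_div_cosh]
    field_simp
  have hΛt : ∀ r : ℝ, 0 < r → Λ r = (m - 1) * (1 / Real.tanh r ^ 2 - 1)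
      - (κ - 1) * (1 - Real.tanh r ^ 2) := by
    intro r hr
    have hC := (Real.cosh_pos r).ne'
    have hS := (Real.sinh_pos_iff.2 hr).ne'
    have e1 : 1 / Real.tanh r ^ 2 - 1 = 1 / Real.sinh r ^ 2 := by
      rw [Real.tanh_eq_sinh_div_cosh]
      field_simp
      linarith [Real.cosh_sq r]
    have e2 : 1 - Real.tanh r ^ 2 = 1 / Real.cosh r ^ 2 := by
      rw [Real.tanh_eq_sinh_div_cosh]
      field_simp
      linarith [Real.cosh_sq r]
    rw [hΛ r hr, e1, e2]
    ring
  have htpos : ∀ r : ℝ, 0 < r → 0 < Real.tanh r := by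
    intro r hr
    rw [Real.tanh_eq_sinh_div_cosh]
    exact div_pos (Real.sinh_pos_iff.2 hr) (Real.cosh_pos r)
  obtain ⟨K, hK⟩ : ∃ K : ℝ, K = 7/8 * (κ - 7/4) := ⟨_, rfl⟩
  obtain ⟨D, hD⟩ : ∃ D : ℝ, D = (5*m - 12*κ + 38)/24 := ⟨_, rfl⟩
  have hden : ∀ r : ℝ, 0 < 1 - 3/4 * Real.tanh r ^ 2 := by
    intro r
    linarith [aux_tanh_sq r]
  -- subsolution
  obtain ⟨z, hzdef⟩ : ∃ z : ℝ → ℝ, ∀ r, z r =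
    (ν - D - K * Real.tanh r ^ 2) / (1 - 3/4 * Real.tanh r ^ 2) := ⟨_, fun _ => rfl⟩
  obtain ⟨zx, hzxdef⟩ : ∃ zx : ℝ → ℝ, ∀ r, zx r =
    (3/4 * z r - K) / (1 - 3/4 * Real.tanh r ^ 2) := ⟨_, fun _ => rfl⟩
  have hz : ∀ r, z r * (1 - 3/4 * Real.tanh r ^ 2) = ν - D - K * Real.tanh r ^ 2 := by
    intro r
    rw [hzdef, div_mul_cancel₀ _ (hden r).ne']
  have hzx : ∀ r, zx r * (1 - 3/4 * Real.tanh r ^ 2) = 3/4 * z r - K := by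
    intro r
    rw [hzxdef, div_mul_cancel₀ _ (hden r).ne']
  have hzd : ∀ r, HasDerivAt z (2 * Real.tanh r * (1 - Real.tanh r ^ 2) * zx r) r := by
    intro r
    have ht := (aux_tanh r).pow 2
    have h := ((ht.const_mul K).const_sub (ν - D)).div ((ht.const_mul (3/4:ℝ)).const_sub 1)
      (hden r).ne'
    have h2 := h.congr_of_eventuallyEq (f₁ := z) (Filter.Eventually.of_forall hzdef)
    refine h2.congr_deriv ?_
    simp only [Pi.pow_apply]
    rw [div_eq_iff (pow_ne_zero 2 (hden r).ne')]
    push_cast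
    linear_combination (-(3/2) * Real.tanh r * (1 - Real.tanh r ^ 2)) * hz r
      - (2 * Real.tanh r * (1 - Real.tanh r ^ 2) * (1 - 3/4 * Real.tanh r ^ 2)) * hzx r
  have hzc : Continuous z := continuous_iff_continuousAt.2 fun r => (hzd r).continuousAt
  have htc : Continuous Real.tanh := continuous_iff_continuousAt.2 fun r => (aux_tanh r).continuousAt
  have hyc : Continuous (fun r => Real.tanh r * z r) := htc.mul hzc
  obtain ⟨Y, hY⟩ : ∃ Y : ℝ → ℝ, ∀ r, HasDerivAt Y (Real.tanh r * z r) r :=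
    ⟨fun r => ∫ s in (0:ℝ)..r, Real.tanh s * z s, fun r =>
      intervalIntegral.integral_hasDerivAt_right (hyc.intervalIntegrable _ _)
        (hyc.stronglyMeasurableAtFilter _ _) hyc.continuousAt⟩
  have hYc : Continuous Y := continuous_iff_continuousAt.2 fun r => (hY r).continuousAt
  have hg₂0 : Filter.Tendsto g₂ (nhdsWithin 0 (Set.Ioi 0)) (nhds 0) := by
    have h1 : Filter.Tendsto (fun r : ℝ => r) (nhdsWithin 0 (Set.Ioi 0)) (nhds 0) :=
      Filter.tendsto_id.mono_left nhdsWithin_le_nhds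
    have h2 := hg₂lim.mul h1
    rw [mul_zero] at h2
    refine h2.congr' ?_
    filter_upwards [self_mem_nhdsWithin] with r hr
    have : r ≠ 0 := ne_of_gt hr
    field_simp
  -- step 1
  have hstep : ∀ r ∈ Set.Ioc (0:ℝ) R, 0 ≤ -(g₁' r + Real.tanh r * z r * g₁ r) := by
    have key := aux_nonneg
      (fun r => -(g₁' r + Real.tanh r * z r * g₁ r) *
        (Real.sinh r ^ (N+1) * Real.cosh r ^ (j+1)) * Real.exp (-Y r))
      (fun r => (m * (ν - z r) + Real.tanh r ^ 2 * (z r ^ 2 - (κ - 2) * z r)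
          - 2 * Real.tanh r ^ 2 * (1 - Real.tanh r ^ 2) * zx r) * g₁ r *
        (Real.sinh r ^ (N+1) * Real.cosh r ^ (j+1)) * Real.exp (-Y r)) R ?_ ?_ ?_
    · intro r hr
      have h := key r hr
      have hS := Real.sinh_pos_iff.2 hr.1
      have hC := Real.cosh_pos r
      have h1 : 0 < (Real.sinh r ^ (N+1) * Real.cosh r ^ (j+1)) * Real.exp (-Y r) := by positivity
      simp only [mul_assoc] at h h1 ⊢
      exact nonneg_of_mul_nonneg_left h h1
    · intro r hr
      have h := ((((hg₁d' r hr).add (((aux_tanh r).mul (hzd r)).mul (hg₁d r hr))).neg).mul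
        (aux_mu N j r hr)).mul ((hY r).neg.exp)
      refine h.congr_deriv ?_
      have hg'' : g₁'' r = -(H r * g₁' r) - lam1 * g₁ r := by linarith [hg₁ode r hr]
      have ht := (htpos r hr).ne'
      simp only [Pi.mul_apply, Pi.add_apply, Pi.neg_apply]
      rw [hg'', hHt r hr, hν]
      have eN : (N:ℝ) = m - 2 := by linarith
      have ej : (j:ℝ) = κ - 2 := by linarith
      rw [eN, ej]
      field_simp
      ring
    · intro r hr
      have hS := Real.sinh_pos_iff.2 hr.1
      have hC := Real.cosh_pos r
      have hg := hg₁pos r hr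
      have hA := aux_alg κ m K D ν (Real.tanh r ^ 2) (z r) (zx r) (sq_nonneg _) (aux_tanh_sq r)
        hkm hK hD (hz r) (hzx r)
      positivity
    · have hc1 : Filter.Tendsto (fun r => Real.tanh r * z r) (nhdsWithin 0 (Set.Ioi 0))
          (nhds (Real.tanh 0 * z 0)) := (hyc.tendsto 0).mono_left nhdsWithin_le_nhds
      have hcont : Continuous (fun r => (Real.sinh r ^ (N+1) * Real.cosh r ^ (j+1))) := by fun_prop
      have hc2 := (hcont.tendsto 0).mono_left (nhdsWithin_le_nhds (s := Set.Ioi 0))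
      have hcont3 : Continuous (fun r => Real.exp (-Y r)) := by fun_prop
      have hc3 := (hcont3.tendsto 0).mono_left (nhdsWithin_le_nhds (s := Set.Ioi 0))
      have h := (((hg₁'lim.add (hc1.mul hg₁lim)).neg).mul hc2).mul hc3
      simpa using h
  -- step 2
  obtain ⟨w, hw⟩ : ∃ w : ℝ → ℝ, w = (fun x => Real.sinh x ^ (N+1) * Real.cosh x ^ (j+1) *
    Real.cosh x ^ (-(3/4) : ℝ)) := ⟨_, rfl⟩
  have hwd : ∀ r : ℝ, 0 < r → HasDerivAt w ((H r - 3/4 * Real.tanh r) * w r) r := by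
    intro r hr
    rw [hw]
    refine (aux_w N j r hr).congr_deriv ?_
    have eN : (N:ℝ) = m - 2 := by linarith
    have ej : (j:ℝ) = κ - 2 := by linarith
    rw [eN, ej, hHt r hr]
    ring
  have hwpos : ∀ r : ℝ, 0 < r → 0 < w r := by
    intro r hr
    rw [hw]
    have hS := Real.sinh_pos_iff.2 hr
    have hC := Real.cosh_pos r
    positivity
  have hw0 : Filter.Tendsto w (nhdsWithin 0 (Set.Ioi 0)) (nhds 0) := by
    have hcont : Continuous w := by
      rw [hw]
      have : Continuous (fun x => Real.cosh x ^ (-(3/4) : ℝ)) :=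
        Real.continuous_cosh.rpow_const fun x => Or.inl (Real.cosh_pos x).ne'
      fun_prop
    have h := (hcont.tendsto 0).mono_left (nhdsWithin_le_nhds (s := Set.Ioi 0))
    have e : w 0 = 0 := by rw [hw]; simp
    rwa [e] at h
  let Φ : ℝ → ℝ := fun r => w r * (Real.sinh r * (g₂' r * g₁ r - g₁' r * g₂ r)
    - (Real.cosh r - 3/4 * (Real.sinh r * Real.tanh r)) * (g₁ r * g₂ r))
  let Φ' : ℝ → ℝ := fun r => w r * Real.cosh r * (
    -(2 * (1 - 3/4 * Real.tanh r ^ 2) * g₁' r * g₂ r)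
    - Real.tanh r * (m + 2 * κ - 2 - 3/4 * (m+2) - 2 * K * Real.tanh r ^ 2 - lam1 + lam2)
      * (g₁ r * g₂ r))
  have hΦd : ∀ r : ℝ, 0 < r → HasDerivAt Φ (Φ' r) r := by
    intro r hr
    have h := (hwd r hr).mul (((Real.hasDerivAt_sinh r).mul
      (((hg₂d' r hr).mul (hg₁d r hr)).sub ((hg₁d' r hr).mul (hg₂d r hr)))).sub
      (((Real.hasDerivAt_cosh r).sub
        (((Real.hasDerivAt_sinh r).mul (aux_tanh r)).const_mul (3/4:ℝ))).mul
        ((hg₁d r hr).mul (hg₂d r hr))))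
    refine h.congr_deriv ?_
    have hg1'' : g₁'' r = -(H r * g₁' r) - lam1 * g₁ r := by linarith [hg₁ode r hr]
    have hg2'' : g₂'' r = -(H r * g₂' r) - (lam2 - Λ r) * g₂ r := by linarith [hg₂ode r hr]
    have ht := (htpos r hr).ne'
    have hS : Real.sinh r = Real.tanh r * Real.cosh r := by
      rw [Real.tanh_eq_sinh_div_cosh, div_mul_cancel₀ _ (Real.cosh_pos r).ne']
    simp only [Pi.mul_apply, Pi.add_apply, Pi.neg_apply, Pi.sub_apply, Φ']
    rw [hg1'', hg2'', hHt r hr, hΛt r hr, hS, hK]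
    field_simp
    ring
  have hΦpos : ∀ r ∈ Set.Ioo (0:ℝ) R, 0 < Φ' r := by
    intro r hr
    have hw' := hwpos r hr.1
    have hC := Real.cosh_pos r
    have h1 := hg₁pos r hr
    have h2 := hg₂pos r hr
    have ht := htpos r hr.1
    have hs := hstep r ⟨hr.1, hr.2.le⟩
    have hd := hden r
    refine mul_pos (mul_pos hw' hC) ?_
    have e1 : 0 ≤ 2 * (1 - 3/4 * Real.tanh r ^ 2) * g₂ r *
        (-(g₁' r + Real.tanh r * z r * g₁ r)) := by positivity
    have e2 : 0 < Real.tanh r * (g₁ r * g₂ r) * ((m + 2) * ν - (2 * m + 3 * κ - 1) / 3 - lam2) := by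
      have : 0 < (m + 2) * ν - (2 * m + 3 * κ - 1) / 3 - lam2 := by linarith
      positivity
    have e3 := hz r
    have e4 : -(2 * (1 - 3/4 * Real.tanh r ^ 2) * g₁' r * g₂ r)
      - Real.tanh r * (m + 2 * κ - 2 - 3/4 * (m+2) - 2 * K * Real.tanh r ^ 2 - lam1 + lam2)
      * (g₁ r * g₂ r) = 2 * (1 - 3/4 * Real.tanh r ^ 2) * g₂ r *
        (-(g₁' r + Real.tanh r * z r * g₁ r)) +
        Real.tanh r * (g₁ r * g₂ r) * ((m + 2) * ν - (2 * m + 3 * κ - 1) / 3 - lam2) := by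
      rw [hν]
      rw [hD] at e3
      linear_combination (2 * g₂ r * Real.tanh r * g₁ r) * e3
    rw [e4]
    linarith
  have hΦ0 : Filter.Tendsto Φ (nhdsWithin 0 (Set.Ioi 0)) (nhds 0) := by
    have hs := (Real.continuous_sinh.tendsto 0).mono_left (nhdsWithin_le_nhds (s := Set.Ioi 0))
    have hcont : Continuous (fun r => Real.cosh r - 3/4 * (Real.sinh r * Real.tanh r)) := by
      fun_prop
    have hc := (hcont.tendsto 0).mono_left (nhdsWithin_le_nhds (s := Set.Ioi 0))
    have h := hw0.mul ((hs.mul ((hg₂'lim.mul hg₁lim).sub (hg₁'lim.mul hg₂0))).sub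
      (hc.mul (hg₁lim.mul hg₂0)))
    simpa using h
  have hnn := aux_nonneg Φ Φ' R hΦd (fun r hr => (hΦpos r hr).le) hΦ0 (R/2)
    ⟨by linarith, by linarith⟩
  have hsm : StrictMonoOn Φ (Set.Icc (R/2) R) := by
    apply strictMonoOn_of_deriv_pos (convex_Icc _ _)
    · intro x hx
      exact (hΦd x (by linarith [hx.1])).continuousAt.continuousWithinAt
    · intro x hx
      rw [interior_Icc] at hx
      rw [(hΦd x (by linarith [hx.1])).deriv]
      exact hΦpos x ⟨by linarith [hx.1], hx.2⟩
  have hlt := hsm ⟨le_refl _, by linarith⟩ ⟨by linarith, le_refl _⟩ (show R/2 < R by linarith)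
  have hΦR : Φ R = 0 := by simp [Φ, hg₁R, hg₂R]
  linarith
end
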